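/- In a finite deterministic episodic MDP with behavior policy β, for every consistent feasible conditioning function f ∈ F^Cst_β, the in-distribution optimal stitched policy satisfies J(π*_β) ≥ J(π_f). -/

import Mathlib

open Finset

namespace RCSL

noncomputable section

/-- Real-valued indicator of a proposition. -/
def ind (P : Prop) : ℝ :=
  haveI := Classical.propDecidable P
  if P then 1 else 0

/-- A finite deterministic episodic MDP with horizon `H`.  Stages are 0-indexed
(`0, …, H-1` here corresponds to the paper's stages `1, …, H`). -/
structure DetMDP (S A : Type) [Fintype S] [Fintype A] (H : ℕ) where
  /-- deterministic transition function -/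
  step : ℕ → S → A → S
  /-- deterministic reward function -/
  r : ℕ → S → A → ℝ
  r_nonneg : ∀ h s a, 0 ≤ r h s a
  r_le_one : ∀ h s a, r h s a ≤ 1
  /-- initial state distribution -/
  ρ : S → ℝ
  ρ_nonneg : ∀ s, 0 ≤ ρ s
  ρ_sum_one : ∑ s, ρ s = 1

/-- Stagewise weight functions on actions; genuine policies are those satisfying `IsPolicy`. -/
abbrev Pol (S A : Type) := ℕ → S → A → ℝ

variable {S A : Type} [Fintype S] [Fintype A] [Nonempty S] [Nonempty A] {H : ℕ}

/-- `π` is a genuine stagewise policy: at every stage and state it is a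
probability distribution on actions. -/
def IsPolicy (π : Pol S A) : Prop :=
  (∀ h s a, 0 ≤ π h s a) ∧ ∀ h s, ∑ a, π h s a = 1

/-- Length-`H` trajectories: a state–action pair at every stage. -/
abbrev Traj (S A : Type) (H : ℕ) := Fin H → S × A

/-- The state of trajectory `τ` at (0-indexed) stage `h`. -/
def stAt (τ : Traj S A H) (h : ℕ) : S :=
  if hh : h < H then (τ ⟨h, hh⟩).1 else Classical.arbitrary S

/-- The action of trajectory `τ` at (0-indexed) stage `h`. -/
def actAt (τ : Traj S A H) (h : ℕ) : A :=
  if hh : h < H then (τ ⟨h, hh⟩).2 else Classical.arbitrary A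

/-- The probability `P_β(τ)` of trajectory `τ` when the initial state is drawn from `ρ`,
actions are drawn from the policy `β`, and states follow the deterministic dynamics. -/
def trajProb (M : DetMDP S A H) (β : Pol S A) (τ : Traj S A H) : ℝ :=
  (if 0 < H then M.ρ (stAt τ 0) else 1) *
    (∏ h : Fin H, β h (stAt τ h) (actAt τ h)) *
    ∏ h : Fin H, (if (h : ℕ) + 1 < H then
      ind (stAt τ ((h : ℕ) + 1) = M.step h (stAt τ h) (actAt τ h)) else 1)

/-- The return-to-go `g_h(τ) = Σ_{t ≥ h} r_t(s_t, a_t)` of trajectory `τ` from stage `h`. -/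
def rtg (M : DetMDP S A H) (h : ℕ) (τ : Traj S A H) : ℝ :=
  ∑ t : Fin H, if h ≤ (t : ℕ) then M.r t (stAt τ t) (actAt τ t) else 0

/-- The stage-`h` state occupancy measure `d_h^π` of policy `π`. -/
def occ (M : DetMDP S A H) (π : Pol S A) : ℕ → S → ℝ
  | 0 => M.ρ
  | n + 1 => fun s' => ∑ s, ∑ a, occ M π n s * π n s a * ind (M.step n s a = s')

/-- The expected total reward `J(π)` of policy `π`. -/
def J (M : DetMDP S A H) (π : Pol S A) : ℝ :=
  ∑ h ∈ Finset.range H, ∑ s, ∑ a, occ M π h s * π h s a * M.r h s a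

/-- The conditional action probability `P_β(a_h = a ∣ s_h = s, g_h = g)`. -/
def condA (M : DetMDP S A H) (β : Pol S A) (h : ℕ) (s : S) (g : ℝ) (a : A) : ℝ :=
  (∑ τ : Traj S A H, trajProb M β τ * ind (stAt τ h = s ∧ actAt τ h = a ∧ rtg M h τ = g)) /
    ∑ τ : Traj S A H, trajProb M β τ * ind (stAt τ h = s ∧ rtg M h τ = g)

/-- The in-distribution optimal return-to-go `f⋆(s, h)`: the largest return-to-go at `(s, h)`
along trajectories that are feasible under the behavior policy `β`. -/
def fstar (M : DetMDP S A H) (β : Pol S A) (s : S) (h : ℕ) : ℝ :=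
  sSup {g : ℝ | ∃ τ : Traj S A H, 0 < trajProb M β τ ∧ stAt τ h = s ∧ rtg M h τ = g}

/-- The return-conditioned policy `π_f(a ∣ s, h) = P_β(a_h = a ∣ s_h = s, g_h = f(s, h))`. -/
def rcPolicy (M : DetMDP S A H) (β : Pol S A) (f : S → ℕ → ℝ) : Pol S A :=
  fun h s a => condA M β h s (f s h) a

/-- The in-distribution optimal stitched policy `π⋆_β = π_{f⋆}`. -/
def piStar (M : DetMDP S A H) (β : Pol S A) : Pol S A :=
  rcPolicy M β fun s h => fstar M β s h

/-- Probability that an i.i.d. dataset of `N` trajectories drawn from `P_β` satisfies `E`. -/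
def datasetProb (M : DetMDP S A H) (β : Pol S A) (N : ℕ)
    (E : (Fin N → Traj S A H) → Prop) : ℝ :=
  ∑ D : Fin N → Traj S A H, (∏ k, trajProb M β (D k)) * ind (E D)

/-- `f` (with domain `dom ⊆ S × {0, …, H-1}`) is a feasible conditioning function
(`f ∈ F_β`). -/
def IsFeasibleCond (M : DetMDP S A H) (β : Pol S A) (f : S → ℕ → ℝ)
    (dom : Set (S × ℕ)) : Prop :=
  ∀ p ∈ dom, p.2 < H ∧
    ∃ τ : Traj S A H, 0 < trajProb M β τ ∧ stAt τ p.2 = p.1 ∧ rtg M p.2 τ = f p.1 p.2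

/-- `f` is a consistent feasible conditioning function (`f ∈ F^Cst_β`): its domain contains
`(s, 0)` for every initial state `s` in the support of `ρ`, the conditioned initial return
occurs with positive probability under `β` from `s`, and along every trajectory generated by
`π_f` one has `f(s_h, h) = r_h(s_h, a_h) + f(s_{h+1}, h+1)` (with the convention that the
term `f(s_{H+1}, H+1)` beyond the horizon is `0`). -/
def IsConsistentCond (M : DetMDP S A H) (β : Pol S A) (f : S → ℕ → ℝ)
    (dom : Set (S × ℕ)) : Prop :=
  IsFeasibleCond M β f dom ∧
    (∀ s, 0 < M.ρ s → (s, 0) ∈ dom) ∧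
    (∀ s, 0 < M.ρ s →
      ∃ τ : Traj S A H, 0 < trajProb M β τ ∧ stAt τ 0 = s ∧ rtg M 0 τ = f s 0) ∧
    ∀ τ : Traj S A H, 0 < trajProb M (rcPolicy M β f) τ → ∀ h, h < H →
      (stAt τ h, h) ∈ dom ∧
        f (stAt τ h) h = M.r h (stAt τ h) (actAt τ h) +
          (if h + 1 < H then f (stAt τ (h + 1)) (h + 1) else 0)

end

end RCSL

namespace RCSL

section

/-- The trajectory following `τ₁` up to and including stage `h` and `τ₂` afterwards. -/
def splice {S A : Type} {H : ℕ} (h : ℕ) (τ₁ τ₂ : Traj S A H) : Traj S A H :=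
  fun t => if (t : ℕ) ≤ h then τ₁ t else τ₂ t

theorem stAt_splice {S A : Type} [Nonempty S] {H : ℕ} (h : ℕ) (τ₁ τ₂ : Traj S A H) (k : ℕ) :
    stAt (splice h τ₁ τ₂) k = if k ≤ h then stAt τ₁ k else stAt τ₂ k := by
  unfold stAt splice; split_ifs <;> rfl

theorem actAt_splice {S A : Type} [Nonempty A] {H : ℕ} (h : ℕ) (τ₁ τ₂ : Traj S A H) (k : ℕ) :
    actAt (splice h τ₁ τ₂) k = if k ≤ h then actAt τ₁ k else actAt τ₂ k := by
  unfold actAt splice; split_ifs <;> rfl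

variable {S A : Type} [Fintype S] [Fintype A] {H : ℕ}

theorem ind_nonneg (P : Prop) : 0 ≤ ind P := by
  unfold ind; split_ifs <;> norm_num

theorem ind_pos {P : Prop} (h : P) : 0 < ind P := by
  simp [ind, h]

theorem ind_ne_zero {P : Prop} : ind P ≠ 0 ↔ P := by
  simp [ind]

theorem ind_eq_sum_actions (P Q : Prop) (b : A) :
    ind (P ∧ Q) = ∑ a, ind (P ∧ b = a ∧ Q) := by
  classical
  rw [Finset.sum_eq_single b]
  · simp
  · intro a _ hab
    simp [ind, hab.symm]
  · simp

/-- Every term of the occupancy measure of a nonnegative policy is nonnegative. -/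
theorem occ_nonneg (M : DetMDP S A H) {π : Pol S A} (hπ : ∀ h s a, 0 ≤ π h s a) :
    ∀ h s, 0 ≤ occ M π h s
  | 0, _ => M.ρ_nonneg _
  | h + 1, _ => Finset.sum_nonneg fun s' _ => Finset.sum_nonneg fun a _ =>
      mul_nonneg (mul_nonneg (occ_nonneg M hπ h s') (hπ h s' a)) (ind_nonneg _)

/-- Pushing a function forward along one step of the occupancy recursion. -/
theorem sum_occ_succ_mul (M : DetMDP S A H) (π : Pol S A) (h : ℕ) (g : S → ℝ) :
    ∑ s, occ M π (h + 1) s * g s =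
      ∑ s, ∑ a, occ M π h s * π h s a * g (M.step h s a) := by
  classical
  simp only [occ, Finset.sum_mul]
  rw [Finset.sum_comm]
  refine Finset.sum_congr rfl fun s _ => ?_
  rw [Finset.sum_comm]
  refine Finset.sum_congr rfl fun a _ => ?_
  rw [Finset.sum_eq_single (M.step h s a)]
  · simp [ind]
  · intro s' _ hs'
    simp [ind, hs'.symm]
  · simp

theorem reward_add_sum_occ_succ (M : DetMDP S A H) (π : Pol S A) (h : ℕ) (g : S → ℝ) :
    ∑ s, ∑ a, occ M π h s * π h s a * M.r h s a + ∑ s, occ M π (h + 1) s * g s =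
      ∑ s, occ M π h s * ∑ a, π h s a * (M.r h s a + g (M.step h s a)) := by
  rw [sum_occ_succ_mul, ← Finset.sum_add_distrib]
  refine Finset.sum_congr rfl fun s _ => ?_
  rw [← Finset.sum_add_distrib, Finset.mul_sum]
  exact Finset.sum_congr rfl fun a _ => by ring

/-- A nonnegative supersolution of the Bellman equation bounds the value of a
substochastic policy from above. -/
theorem J_le_of_supersolution (M : DetMDP S A H) {π : Pol S A} {g : ℕ → S → ℝ}
    (hπ : ∀ h s a, 0 ≤ π h s a) (hsum : ∀ h s, ∑ a, π h s a ≤ 1)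
    (hg : ∀ h s, 0 ≤ g h s)
    (hstep : ∀ h < H, ∀ s a, π h s a ≠ 0 →
      M.r h s a + g (h + 1) (M.step h s a) ≤ g h s) :
    J M π ≤ ∑ s, M.ρ s * g 0 s := by
  have key : ∀ n ≤ H, ∑ h ∈ Finset.range n, ∑ s, ∑ a, occ M π h s * π h s a * M.r h s a +
      ∑ s, occ M π n s * g n s ≤ ∑ s, M.ρ s * g 0 s := by
    intro n
    induction n with
    | zero => intro _; simp [occ]
    | succ n ih =>
      intro hn
      refine le_trans ?_ (ih (by omega))
      rw [Finset.sum_range_succ, add_assoc, reward_add_sum_occ_succ]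
      gcongr with s _
      · exact occ_nonneg M hπ n s
      calc ∑ a, π n s a * (M.r n s a + g (n + 1) (M.step n s a))
          ≤ ∑ a, π n s a * g n s := by
            refine Finset.sum_le_sum fun a _ => ?_
            by_cases h0 : π n s a = 0
            · simp [h0]
            · exact mul_le_mul_of_nonneg_left (hstep n (by omega) s a h0) (hπ n s a)
        _ = (∑ a, π n s a) * g n s := by rw [Finset.sum_mul]
        _ ≤ g n s := mul_le_of_le_one_left (hg n s) (hsum n s)
  have h1 := key H le_rfl
  have h2 : 0 ≤ ∑ s, occ M π H s * g H s :=
    Finset.sum_nonneg fun s _ => mul_nonneg (occ_nonneg M hπ H s) (hg H s)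
  unfold J
  linarith

/-- A subsolution of the Bellman equation along the visited states bounds the value of a
policy from below. -/
theorem le_J_of_subsolution (M : DetMDP S A H) {π : Pol S A} {g : ℕ → S → ℝ}
    (hπ : ∀ h s a, 0 ≤ π h s a)
    (hsum : ∀ h < H, ∀ s, occ M π h s ≠ 0 → ∑ a, π h s a = 1)
    (hg : ∀ s, g H s = 0)
    (hstep : ∀ h < H, ∀ s a, π h s a ≠ 0 →
      g h s ≤ M.r h s a + g (h + 1) (M.step h s a)) :
    ∑ s, M.ρ s * g 0 s ≤ J M π := by
  have key : ∀ n ≤ H, ∑ s, M.ρ s * g 0 s ≤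
      ∑ h ∈ Finset.range n, ∑ s, ∑ a, occ M π h s * π h s a * M.r h s a +
      ∑ s, occ M π n s * g n s := by
    intro n
    induction n with
    | zero => intro _; simp [occ]
    | succ n ih =>
      intro hn
      refine (ih (by omega)).trans ?_
      rw [Finset.sum_range_succ, add_assoc, reward_add_sum_occ_succ]
      refine add_le_add le_rfl ?_
      refine Finset.sum_le_sum fun s _ => ?_
      by_cases hs : occ M π n s = 0
      · simp [hs]
      refine mul_le_mul_of_nonneg_left ?_ (occ_nonneg M hπ n s)
      calc g n s = ∑ a, π n s a * g n s := by
            rw [← Finset.sum_mul, hsum n (by omega) s hs, one_mul]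
        _ ≤ _ := by
            refine Finset.sum_le_sum fun a _ => ?_
            by_cases h0 : π n s a = 0
            · simp [h0]
            · exact mul_le_mul_of_nonneg_left (hstep n (by omega) s a h0) (hπ n s a)
  have h1 := key H le_rfl
  simp only [hg, mul_zero, Finset.sum_const_zero, add_zero] at h1
  exact h1

variable [Nonempty S] [Nonempty A]

theorem trajProb_nonneg (M : DetMDP S A H) {β : Pol S A} (hβ : ∀ h s a, 0 ≤ β h s a)
    (τ : Traj S A H) : 0 ≤ trajProb M β τ := by
  unfold trajProb
  refine mul_nonneg (mul_nonneg ?_ ?_) ?_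
  · split_ifs
    · exact M.ρ_nonneg _
    · norm_num
  · exact Finset.prod_nonneg fun h _ => hβ _ _ _
  · refine Finset.prod_nonneg fun h _ => ?_
    split_ifs
    · exact ind_nonneg _
    · norm_num

theorem trajProb_ne_zero_iff (M : DetMDP S A H) {β : Pol S A} (τ : Traj S A H) :
    trajProb M β τ ≠ 0 ↔ (0 < H → M.ρ (stAt τ 0) ≠ 0) ∧
      (∀ h < H, β h (stAt τ h) (actAt τ h) ≠ 0) ∧
      ∀ h, h + 1 < H → stAt τ (h + 1) = M.step h (stAt τ h) (actAt τ h) := by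
  unfold trajProb
  rw [mul_ne_zero_iff, mul_ne_zero_iff, Finset.prod_ne_zero_iff, Finset.prod_ne_zero_iff,
    and_assoc]
  refine and_congr ?_ (and_congr ?_ ?_)
  · by_cases h : 0 < H <;> simp [h]
  · exact ⟨fun h k hk => h ⟨k, hk⟩ (Finset.mem_univ _), fun h k _ => h k k.2⟩
  · constructor
    · intro h k hk
      have := h ⟨k, by omega⟩ (Finset.mem_univ _)
      simpa [hk, ind_ne_zero] using this
    · intro h k _
      split_ifs with hk
      · exact ind_ne_zero.2 (h k hk)
      · norm_num

theorem trajProb_pos_iff (M : DetMDP S A H) {β : Pol S A} (hβ : ∀ h s a, 0 ≤ β h s a)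
    (τ : Traj S A H) : 0 < trajProb M β τ ↔ trajProb M β τ ≠ 0 :=
  (trajProb_nonneg M hβ τ).lt_iff_ne'

/-- Feasible trajectories meeting at stage `h + 1` splice to a feasible trajectory. -/
theorem trajProb_splice_ne_zero (M : DetMDP S A H) {β : Pol S A} {h : ℕ} {τ₁ τ₂ : Traj S A H}
    (h₁ : trajProb M β τ₁ ≠ 0) (h₂ : trajProb M β τ₂ ≠ 0)
    (hmeet : stAt τ₁ (h + 1) = stAt τ₂ (h + 1)) :
    trajProb M β (splice h τ₁ τ₂) ≠ 0 := by
  rw [trajProb_ne_zero_iff] at h₁ h₂ ⊢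
  simp only [stAt_splice, actAt_splice]
  refine ⟨by simpa using h₁.1, fun k hk => ?_, fun k hk => ?_⟩
  · split_ifs
    · exact h₁.2.1 k hk
    · exact h₂.2.1 k hk
  · rcases lt_trichotomy k h with hlt | rfl | hgt
    · rw [if_pos (by omega), if_pos (by omega), if_pos (by omega)]
      exact h₁.2.2 k hk
    · rw [if_neg (by omega), if_pos le_rfl, if_pos le_rfl, ← hmeet]
      exact h₁.2.2 k hk
    · rw [if_neg (by omega), if_neg (by omega), if_neg (by omega)]
      exact h₂.2.2 k hk

theorem rtg_nonneg (M : DetMDP S A H) (h : ℕ) (τ : Traj S A H) : 0 ≤ rtg M h τ :=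
  Finset.sum_nonneg fun t _ => by
    split_ifs
    · exact M.r_nonneg _ _ _
    · exact le_rfl

theorem rtg_succ (M : DetMDP S A H) {h : ℕ} (hh : h < H) (τ : Traj S A H) :
    rtg M h τ = M.r h (stAt τ h) (actAt τ h) + rtg M (h + 1) τ := by
  classical
  unfold rtg
  have h0 : M.r h (stAt τ h) (actAt τ h) =
      ∑ t : Fin H, if (⟨h, hh⟩ : Fin H) = t then M.r t (stAt τ t) (actAt τ t) else 0 := by
    simp
  rw [h0, ← Finset.sum_add_distrib]
  refine Finset.sum_congr rfl fun t _ => ?_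
  simp only [Fin.ext_iff]
  rcases lt_trichotomy h (t : ℕ) with hlt | heq | hgt
  · simp [hlt.le, hlt.ne, Nat.succ_le_of_lt hlt]
  · simp [heq]
  · rw [if_neg (by omega), if_neg (by omega), if_neg (by omega), add_zero]

theorem rtg_eq_zero (M : DetMDP S A H) {h : ℕ} (hh : H ≤ h) (τ : Traj S A H) :
    rtg M h τ = 0 :=
  Finset.sum_eq_zero fun t _ => if_neg (by omega)

theorem rtg_splice (M : DetMDP S A H) (h : ℕ) (τ₁ τ₂ : Traj S A H) :
    rtg M (h + 1) (splice h τ₁ τ₂) = rtg M (h + 1) τ₂ := by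
  refine Finset.sum_congr rfl fun t _ => ?_
  split_ifs with ht
  · rw [stAt_splice, actAt_splice, if_neg (by omega), if_neg (by omega)]
  · rfl

theorem finite_feasible_rtg (M : DetMDP S A H) (β : Pol S A) (s : S) (h : ℕ) :
    {g : ℝ | ∃ τ : Traj S A H, 0 < trajProb M β τ ∧ stAt τ h = s ∧ rtg M h τ = g}.Finite :=
  (Set.finite_range fun τ : Traj S A H => rtg M h τ).subset
    fun _ h => h.imp fun _ hτ => hτ.2.2

theorem rtg_le_fstar (M : DetMDP S A H) {β : Pol S A} {τ : Traj S A H}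
    (hτ : 0 < trajProb M β τ) (h : ℕ) : rtg M h τ ≤ fstar M β (stAt τ h) h :=
  le_csSup (finite_feasible_rtg M β _ h).bddAbove ⟨τ, hτ, rfl, rfl⟩

theorem exists_rtg_eq_fstar (M : DetMDP S A H) {β : Pol S A} {τ : Traj S A H}
    (hτ : 0 < trajProb M β τ) (h : ℕ) :
    ∃ τ' : Traj S A H, 0 < trajProb M β τ' ∧ stAt τ' h = stAt τ h ∧
      rtg M h τ' = fstar M β (stAt τ h) h :=
  (show Set.Nonempty {g : ℝ | ∃ τ' : Traj S A H, 0 < trajProb M β τ' ∧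
      stAt τ' h = stAt τ h ∧ rtg M h τ' = g} from ⟨_, τ, hτ, rfl, rfl⟩).csSup_mem
    (finite_feasible_rtg M β (stAt τ h) h)

theorem fstar_nonneg (M : DetMDP S A H) (β : Pol S A) (s : S) (h : ℕ) : 0 ≤ fstar M β s h := by
  refine Real.sSup_nonneg ?_
  rintro _ ⟨τ, -, -, rfl⟩
  exact rtg_nonneg M h τ

theorem condA_nonneg (M : DetMDP S A H) {β : Pol S A} (hβ : ∀ h s a, 0 ≤ β h s a)
    (h : ℕ) (s : S) (g : ℝ) (a : A) : 0 ≤ condA M β h s g a :=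
  div_nonneg
    (Finset.sum_nonneg fun τ _ => mul_nonneg (trajProb_nonneg M hβ τ) (ind_nonneg _))
    (Finset.sum_nonneg fun τ _ => mul_nonneg (trajProb_nonneg M hβ τ) (ind_nonneg _))

theorem exists_traj_of_condA_ne_zero (M : DetMDP S A H) {β : Pol S A}
    (hβ : ∀ h s a, 0 ≤ β h s a) {h : ℕ} {s : S} {g : ℝ} {a : A}
    (hne : condA M β h s g a ≠ 0) :
    ∃ τ : Traj S A H, 0 < trajProb M β τ ∧ stAt τ h = s ∧ actAt τ h = a ∧ rtg M h τ = g := by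
  obtain ⟨τ, -, hτ⟩ := Finset.exists_ne_zero_of_sum_ne_zero (div_ne_zero_iff.1 hne).1
  rw [mul_ne_zero_iff, ind_ne_zero] at hτ
  exact ⟨τ, (trajProb_pos_iff M hβ τ).2 hτ.1, hτ.2⟩

theorem sum_condA (M : DetMDP S A H) (β : Pol S A) (h : ℕ) (s : S) (g : ℝ) :
    ∑ a, condA M β h s g a =
      (∑ τ : Traj S A H, trajProb M β τ * ind (stAt τ h = s ∧ rtg M h τ = g)) /
        ∑ τ : Traj S A H, trajProb M β τ * ind (stAt τ h = s ∧ rtg M h τ = g) := by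
  unfold condA
  rw [← Finset.sum_div, Finset.sum_comm]
  congr 1
  refine Finset.sum_congr rfl fun τ _ => ?_
  rw [← Finset.mul_sum, ← ind_eq_sum_actions]

theorem sum_condA_eq_one (M : DetMDP S A H) {β : Pol S A} (hβ : ∀ h s a, 0 ≤ β h s a)
    {h : ℕ} {τ : Traj S A H} (hτ : 0 < trajProb M β τ) :
    ∑ a, condA M β h (stAt τ h) (rtg M h τ) a = 1 := by
  rw [sum_condA]
  refine div_self (ne_of_gt ?_)
  exact Finset.sum_pos' (fun τ' _ => mul_nonneg (trajProb_nonneg M hβ τ') (ind_nonneg _))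
    ⟨τ, Finset.mem_univ _, mul_pos hτ (ind_pos ⟨rfl, rfl⟩)⟩

/-- The in-distribution optimal return-to-go, extended by `0` beyond the horizon. -/
noncomputable def optReturn (M : DetMDP S A H) (β : Pol S A) (h : ℕ) (s : S) : ℝ :=
  if h < H then fstar M β s h else 0

theorem optReturn_nonneg (M : DetMDP S A H) (β : Pol S A) (h : ℕ) (s : S) :
    0 ≤ optReturn M β h s := by
  unfold optReturn
  split_ifs
  · exact fstar_nonneg M β s h
  · exact le_rfl

theorem rtg_le_optReturn_step (M : DetMDP S A H) {β : Pol S A} {h : ℕ} {τ : Traj S A H}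
    (hτ : 0 < trajProb M β τ) :
    rtg M (h + 1) τ ≤ optReturn M β (h + 1) (M.step h (stAt τ h) (actAt τ h)) := by
  unfold optReturn
  split_ifs with hh
  · rw [← ((trajProb_ne_zero_iff M τ).1 hτ.ne').2.2 h hh]
    exact rtg_le_fstar M hτ (h + 1)
  · exact (rtg_eq_zero M (by omega) τ).le

theorem reward_add_optReturn_step_le (M : DetMDP S A H) {β : Pol S A}
    (hβ : ∀ h s a, 0 ≤ β h s a) {h : ℕ} (hh : h < H) {τ : Traj S A H}
    (hτ : 0 < trajProb M β τ) :
    M.r h (stAt τ h) (actAt τ h) +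
      optReturn M β (h + 1) (M.step h (stAt τ h) (actAt τ h)) ≤ optReturn M β h (stAt τ h) := by
  rw [optReturn, optReturn, if_pos hh]
  split_ifs with hh'
  · rw [← ((trajProb_ne_zero_iff M τ).1 hτ.ne').2.2 h hh']
    obtain ⟨τ', hτ', hs, hr⟩ := exists_rtg_eq_fstar M hτ (h + 1)
    have hpos := (trajProb_pos_iff M hβ _).2
      (trajProb_splice_ne_zero M hτ.ne' hτ'.ne' hs.symm)
    have hle := rtg_le_fstar M hpos h
    rw [rtg_succ M hh, rtg_splice, stAt_splice, actAt_splice, if_pos le_rfl, if_pos le_rfl,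
      hr] at hle
    exact hle
  · have hle := rtg_le_fstar M hτ h
    rw [rtg_succ M hh, rtg_eq_zero M (by omega)] at hle
    exact hle

/-- Every return-conditioned policy is at most as good as the best in-distribution returns. -/
theorem J_rcPolicy_le (M : DetMDP S A H) {β : Pol S A} (hβ : ∀ h s a, 0 ≤ β h s a)
    (f : S → ℕ → ℝ) : J M (rcPolicy M β f) ≤ ∑ s, M.ρ s * optReturn M β 0 s := by
  refine J_le_of_supersolution M (fun h s a => condA_nonneg M hβ h s _ a) (fun h s => ?_)
    (optReturn_nonneg M β) fun h hh s a hne => ?_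
  · exact (sum_condA M β h s _).trans_le (div_self_le_one _)
  · obtain ⟨τ, hτ, rfl, rfl, -⟩ := exists_traj_of_condA_ne_zero M hβ hne
    exact reward_add_optReturn_step_le M hβ hh hτ

/-- States visited by a return-conditioned policy are visited by the behavior policy. -/
theorem exists_traj_of_occ_rcPolicy_ne_zero (M : DetMDP S A H) {β : Pol S A}
    (hβ : ∀ h s a, 0 ≤ β h s a)
    (hstart : ∀ s, 0 < M.ρ s → ∃ τ : Traj S A H, 0 < trajProb M β τ ∧ stAt τ 0 = s)
    (f : S → ℕ → ℝ) {h : ℕ} (hh : h < H) {s : S} (hs : occ M (rcPolicy M β f) h s ≠ 0) :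
    ∃ τ : Traj S A H, 0 < trajProb M β τ ∧ stAt τ h = s := by
  cases h with
  | zero => exact hstart s ((M.ρ_nonneg s).lt_of_ne' hs)
  | succ h =>
    obtain ⟨s', -, hs'⟩ := Finset.exists_ne_zero_of_sum_ne_zero hs
    obtain ⟨a, -, ha⟩ := Finset.exists_ne_zero_of_sum_ne_zero hs'
    rw [mul_ne_zero_iff, mul_ne_zero_iff, ind_ne_zero] at ha
    obtain ⟨τ, hτ, rfl, rfl, -⟩ := exists_traj_of_condA_ne_zero M hβ ha.1.2
    exact ⟨τ, hτ, (((trajProb_ne_zero_iff M τ).1 hτ.ne').2.2 h hh).trans ha.2⟩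

/-- The optimal stitched policy achieves at least the best in-distribution returns. -/
theorem le_J_piStar (M : DetMDP S A H) {β : Pol S A} (hβ : ∀ h s a, 0 ≤ β h s a)
    (hstart : ∀ s, 0 < M.ρ s → ∃ τ : Traj S A H, 0 < trajProb M β τ ∧ stAt τ 0 = s) :
    ∑ s, M.ρ s * optReturn M β 0 s ≤ J M (piStar M β) := by
  refine le_J_of_subsolution M (fun h s a => condA_nonneg M hβ h s _ a) (fun h hh s hs => ?_)
    (fun s => if_neg (lt_irrefl H)) fun h hh s a hne => ?_
  · obtain ⟨τ, hτ, rfl⟩ := exists_traj_of_occ_rcPolicy_ne_zero M hβ hstart _ hh hs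
    obtain ⟨τ', hτ', hs', hr⟩ := exists_rtg_eq_fstar M hτ h
    have hsum := sum_condA_eq_one M hβ (h := h) hτ'
    rw [hs', hr] at hsum
    exact hsum
  · obtain ⟨τ, hτ, rfl, rfl, hr⟩ := exists_traj_of_condA_ne_zero M hβ hne
    have hle := rtg_le_optReturn_step M (h := h) hτ
    simp only at hr
    rw [optReturn, if_pos hh, ← hr, rtg_succ M hh]
    exact add_le_add_right hle _

end

/-- In a finite deterministic episodic MDP with behavior policy `β`,
for every consistent feasible conditioning function `f ∈ F^Cst_β`, the in-distribution
optimal stitched policy satisfies `J(π⋆_β) ≥ J(π_f)`. -/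
theorem stmt0 {S A : Type} [Fintype S] [Fintype A] [Nonempty S] [Nonempty A] {H : ℕ}
    (M : DetMDP S A H) (β : Pol S A) (hβ : IsPolicy β)
    (f : S → ℕ → ℝ) (dom : Set (S × ℕ)) (hf : IsConsistentCond M β f dom) :
    J M (rcPolicy M β f) ≤ J M (piStar M β) := by
  have hstart : ∀ s, 0 < M.ρ s → ∃ τ : Traj S A H, 0 < trajProb M β τ ∧ stAt τ 0 = s := by
    intro s hs
    obtain ⟨τ, hτ, h0, -⟩ := hf.2.2.1 s hs
    exact ⟨τ, hτ, h0⟩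
  exact (J_rcPolicy_le M hβ.1 f).trans (le_J_piStar M hβ.1 hstart)

end RCSL
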